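/- Assume condition (L): p > 2, or p < 2 and α < δ. Let w be a solution of equation (E) on [r₀,∞) such that lim_{r→∞} r^α w(r) = 0. (i) If p > 2, then w has compact support, i.e. there exists R > 0 with w ≡ 0 on [R,∞). (ii) If p < 2, then w(r) = O(r^{-δ}) as r → ∞. -/

import Mathlib

open Set Filter Topology Asymptotics

/-- The p-Laplacian nonlinearity φ_p(x) = |x|^{p-2} x. -/
noncomputable def phiP (p x : ℝ) : ℝ := |x| ^ (p - 2) * x

/-- `w` is a solution of equation (E) on the interval `I ⊆ (0,∞)`:
`w` is C¹ on `I`, `|w'|^{p-2} w'` is C¹ on `I`, and the equation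
`(|w'|^{p-2}w')' + ((N-1)/r)|w'|^{p-2}w' + r w' + α w + |w|^{q-1} w = 0`
holds on `I` (derivatives taken within `I`). -/
def IsSolutionOn (N : ℕ) (p q α : ℝ) (w : ℝ → ℝ) (I : Set ℝ) : Prop :=
  ContDiffOn ℝ 1 w I ∧
  ContDiffOn ℝ 1 (fun r => phiP p (derivWithin w I r)) I ∧
  ∀ r ∈ I,
    derivWithin (fun s => phiP p (derivWithin w I s)) I r
      + ((N : ℝ) - 1) / r * phiP p (derivWithin w I r)
      + r * derivWithin w I r + α * w r + |w r| ^ (q - 1) * w r = 0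

/-- `w` is the global solution of (E) on `[0,∞)` with `w(0) = a`, `w'(0) = 0`:
`w ∈ C¹([0,∞))`, `|w'|^{p-2}w' ∈ C¹([0,∞))`, and (E) holds on `(0,∞)`. -/
def IsGlobalSolution (N : ℕ) (p q α a : ℝ) (w : ℝ → ℝ) : Prop :=
  ContDiffOn ℝ 1 w (Ici 0) ∧
  ContDiffOn ℝ 1 (fun r => phiP p (derivWithin w (Ici 0) r)) (Ici 0) ∧
  (∀ r ∈ Ioi (0 : ℝ),
    derivWithin (fun s => phiP p (derivWithin w (Ici 0) s)) (Ici 0) r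
      + ((N : ℝ) - 1) / r * phiP p (derivWithin w (Ici 0) r)
      + r * derivWithin w (Ici 0) r + α * w r + |w r| ^ (q - 1) * w r = 0) ∧
  w 0 = a ∧ derivWithin w (Ici 0) 0 = 0

/-- `r` is an isolated zero of `w` relative to the set `I`. -/
def IsIsolatedZeroOn (w : ℝ → ℝ) (I : Set ℝ) (r : ℝ) : Prop :=
  r ∈ I ∧ w r = 0 ∧ ∀ᶠ s in 𝓝[I \ {r}] r, w s ≠ 0

/-- `w` has at least `n` isolated zeros in `(0,∞)`. -/
def HasAtLeastIsolatedZeros (w : ℝ → ℝ) (n : ℕ) : Prop :=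
  ∃ z : Fin n → ℝ, StrictMono z ∧ ∀ i, 0 < z i ∧ IsIsolatedZeroOn w (Ici 0) (z i)

theorem abs_phiP {p : ℝ} (hp : 1 < p) (x : ℝ) : |phiP p x| = |x| ^ (p - 1) := by
  rcases eq_or_ne x 0 with rfl | hx
  · simp [phiP, Real.zero_rpow (sub_pos.2 hp).ne']
  · have hx' : 0 < |x| := abs_pos.2 hx
    rw [phiP, abs_mul, abs_of_pos (Real.rpow_pos_of_pos hx' _), ← Real.rpow_add_one hx'.ne']
    congr 1
    ring

theorem phiP_neg (p x : ℝ) : phiP p (-x) = -phiP p x := by simp [phiP]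

theorem phiP_pos_iff {p x : ℝ} : 0 < phiP p x ↔ 0 < x := by
  rcases lt_trichotomy x 0 with hx | rfl | hx
  · have h1 : 0 < |x| ^ (p - 2) := Real.rpow_pos_of_pos (abs_pos.2 hx.ne) _
    have h2 : phiP p x < 0 := mul_neg_of_pos_of_neg h1 hx
    constructor <;> intro h <;> linarith
  · simp [phiP]
  · have h1 : 0 < |x| ^ (p - 2) := Real.rpow_pos_of_pos (abs_pos.2 hx.ne') _
    exact iff_of_true (mul_pos h1 hx) hx

/-- `w`, with derivative `v`, solves (E) on the open half-line `(r₀,∞)`, with a real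
parameter `n` in place of the dimension. -/
structure SolvesAfter (n p q α r₀ : ℝ) (w v : ℝ → ℝ) : Prop where
  hasDerivAt : ∀ r, r₀ < r → HasDerivAt w (v r) r
  hasDerivAt_flux : ∀ r, r₀ < r → HasDerivAt (fun s => phiP p (v s))
    (-((n - 1) / r * phiP p (v r) + r * v r + α * w r + |w r| ^ (q - 1) * w r)) r

theorem IsSolutionOn.solvesAfter {N : ℕ} {p q α r₀ : ℝ} {w : ℝ → ℝ}
    (hw : IsSolutionOn N p q α w (Ici r₀)) :
    SolvesAfter N p q α r₀ w (derivWithin w (Ici r₀)) := by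
  obtain ⟨h1, h2, h3⟩ := hw
  constructor
  · intro r hr
    exact ((h1.differentiableOn one_ne_zero) r hr.le).hasDerivWithinAt.hasDerivAt (Ici_mem_nhds hr)
  · intro r hr
    have h := ((h2.differentiableOn one_ne_zero) r hr.le).hasDerivWithinAt.hasDerivAt
      (Ici_mem_nhds hr)
    exact h.congr_deriv (by linarith [h3 r hr.le])

theorem exists_max_of_tendsto_zero {f : ℝ → ℝ} {r s₀ : ℝ} (hf : ContinuousOn f (Ici r))
    (h0 : Tendsto f atTop (𝓝 0)) (hs : r ≤ s₀) (hpos : 0 < f s₀) :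
    ∃ c, r ≤ c ∧ ∀ s, r ≤ s → f s ≤ f c := by
  obtain ⟨T, hT⟩ := eventually_atTop.1 (h0.eventually_lt_const hpos)
  have hmem : s₀ ∈ Icc r (max s₀ T) := ⟨hs, le_max_left _ _⟩
  obtain ⟨c, hc, hmax⟩ := isCompact_Icc.exists_isMaxOn ⟨s₀, hmem⟩ (hf.mono Icc_subset_Ici_self)
  refine ⟨c, hc.1, fun s hrs => ?_⟩
  rcases le_total s (max s₀ T) with h | h
  · exact hmax ⟨hrs, h⟩
  · exact (hT s ((le_max_right _ _).trans h)).le.trans (hmax hmem)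

theorem HasDerivAt.nonpos_of_max_right {f : ℝ → ℝ} {f' r : ℝ} (hf : HasDerivAt f f' r)
    (hmax : ∀ s, r ≤ s → f s ≤ f r) : f' ≤ 0 := by
  have hloc : IsLocalMaxOn f (Ici r) r := eventually_mem_nhdsWithin.mono hmax
  have := hloc.hasFDerivWithinAt_nonpos hf.hasFDerivAt.hasFDerivWithinAt (y := 1)
    (mem_posTangentConeAt_of_segment_subset (by
      rw [segment_eq_Icc (by linarith)]; exact Icc_subset_Ici_self))
  simpa using this

theorem HasDerivAt.nonneg_of_max_left {f : ℝ → ℝ} {f' a r : ℝ} (har : a < r)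
    (hf : HasDerivAt f f' r) (hmax : ∀ s, a ≤ s → s ≤ r → f s ≤ f r) : 0 ≤ f' := by
  have hloc : IsLocalMaxOn f (Icc a r) r :=
    eventually_mem_nhdsWithin.mono fun s hs => hmax s hs.1 hs.2
  have := hloc.hasFDerivWithinAt_nonpos hf.hasFDerivAt.hasFDerivWithinAt (y := a - r)
    (sub_mem_posTangentConeAt_of_segment_subset (by
      rw [segment_symm, segment_eq_Icc har.le]))
  simp only [ContinuousLinearMap.toSpanSingleton_apply, smul_eq_mul] at this
  nlinarith

namespace SolvesAfter

variable {n p q α r₀ : ℝ} {w v : ℝ → ℝ}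

theorem neg (h : SolvesAfter n p q α r₀ w v) :
    SolvesAfter n p q α r₀ (fun r => -w r) (fun r => -v r) := by
  constructor
  · intro r hr
    exact (h.hasDerivAt r hr).neg
  · intro r hr
    simp only [phiP_neg, abs_neg]
    exact (h.hasDerivAt_flux r hr).neg.congr_deriv (by ring)

theorem hasDerivAt_rpow_mul (h : SolvesAfter n p q α r₀ w v) (hr₀ : 0 < r₀) (γ : ℝ) {r : ℝ}
    (hr : r₀ < r) :
    HasDerivAt (fun s => s ^ γ * w s) (r ^ γ * (γ * w r + r * v r) / r) r := by
  have hr' : 0 < r := hr₀.trans hr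
  refine ((Real.hasDerivAt_rpow_const (p := γ) (Or.inl hr'.ne')).mul
    (h.hasDerivAt r hr)).congr_deriv ?_
  rw [Real.rpow_sub_one hr'.ne']
  field_simp

theorem hasDerivAt_rpow_mul_flux (h : SolvesAfter n p q α r₀ w v) (hr₀ : 0 < r₀) {r : ℝ}
    (hr : r₀ < r) :
    HasDerivAt (fun s => s ^ (α - 1) * phiP p (v s))
      (((α - n) * (r ^ (α - 1) * phiP p (v r)) - r ^ (α + 1) * v r
        - (α + |w r| ^ (q - 1)) * (r ^ α * w r)) / r) r := by
  have hr' : 0 < r := hr₀.trans hr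
  refine ((Real.hasDerivAt_rpow_const (p := α - 1) (Or.inl hr'.ne')).mul
    (h.hasDerivAt_flux r hr)).congr_deriv ?_
  rw [Real.rpow_sub_one hr'.ne' (α - 1), Real.rpow_sub_one hr'.ne' α, Real.rpow_add_one hr'.ne']
  field_simp
  ring

theorem rpow_mul_abs_phiP_le (hp : 1 < p) {A D s x : ℝ} (hA : 0 ≤ A) (hD : 0 ≤ D) (hs : 0 < s)
    (hx : s ^ (α + 1) * |x| ≤ D * A) :
    s ^ (α - 1) * |phiP p x| ≤ D ^ (p - 1) * A ^ (p - 1) * s ^ (-(p - α * (2 - p))) := by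
  have hx' : |x| ≤ D * A * s ^ (-(α + 1)) := by
    rw [Real.rpow_neg hs.le, ← div_eq_mul_inv, le_div_iff₀ (Real.rpow_pos_of_pos hs _)]
    linarith
  rw [abs_phiP hp]
  calc s ^ (α - 1) * |x| ^ (p - 1) ≤ s ^ (α - 1) * (D * A * s ^ (-(α + 1))) ^ (p - 1) := by
        gcongr
    _ = D ^ (p - 1) * A ^ (p - 1) * (s ^ (α - 1) * s ^ (-(α + 1) * (p - 1))) := by
        rw [Real.mul_rpow (by positivity) (by positivity), Real.mul_rpow hD hA,
          ← Real.rpow_mul hs.le]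
        ring
    _ = _ := by
        rw [← Real.rpow_add hs]
        ring_nf

theorem hasDerivAt_add_rpow (a b κ τ : ℝ) {s : ℝ} (hs : 0 < s) :
    HasDerivAt (fun s : ℝ => a * s ^ (-κ) + b * s ^ (-τ))
      (-(κ * (a * s ^ (-κ)) + τ * (b * s ^ (-τ))) / s) s := by
  refine (((Real.hasDerivAt_rpow_const (p := -κ) (Or.inl hs.ne')).const_mul a).add
    ((Real.hasDerivAt_rpow_const (p := -τ) (Or.inl hs.ne')).const_mul b)).congr_deriv ?_
  rw [Real.rpow_sub_one hs.ne', Real.rpow_sub_one hs.ne']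
  field_simp
  ring

/-- Upper barrier for the rescaled flux, past a point after which `r ^ α * |w r|` stays
below `A`. -/
theorem flux_le_barrier (h : SolvesAfter n p q α r₀ w v) (hr₀ : 0 < r₀) (hp : 1 < p) (hq : 1 < q)
    (hα : 0 < α) {κ ε A r : ℝ} (hτ : 0 < p - α * (2 - p)) (hκ : p - α * (2 - p) ≤ κ)
    (hε : 0 < ε) (hε' : ε ≤ 1 / 2) (hA : 0 < A) (hr : r₀ < r)
    (hw1 : ∀ s, r ≤ s → |w s| ≤ 1) (hY : ∀ s, r ≤ s → s ^ α * |w s| ≤ A)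
    (hbig : (κ + |α - n| + α + 1) ^ (p - 1) * A ^ (p - 1)
      ≤ ε * (r ^ (p - α * (2 - p)) * A))
    (hX : r ^ (α - 1) * phiP p (v r) ≤ A / 2) {s : ℝ} (hs : r ≤ s) :
    s ^ (α - 1) * phiP p (v s) ≤ A / 2 * r ^ κ * s ^ (-κ)
      + ε * A * r ^ (p - α * (2 - p)) * s ^ (-(p - α * (2 - p))) := by
  set τ := p - α * (2 - p) with hτdef
  have hrpos : 0 < r := hr₀.trans hr
  have hκ0 : 0 < κ := hτ.trans_le hκ
  refine image_le_of_deriv_right_lt_deriv_boundary' (a := r) (b := s)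
    (f := fun s => s ^ (α - 1) * phiP p (v s))
    (B := fun s => A / 2 * r ^ κ * s ^ (-κ) + ε * A * r ^ τ * s ^ (-τ))
    (fun t ht => (h.hasDerivAt_rpow_mul_flux hr₀
      (hr.trans_le ht.1)).continuousAt.continuousWithinAt)
    (fun t ht => (h.hasDerivAt_rpow_mul_flux hr₀ (hr.trans_le ht.1)).hasDerivWithinAt) ?_
    (fun t ht => (hasDerivAt_add_rpow _ _ κ τ
      (hrpos.trans_le ht.1)).continuousAt.continuousWithinAt)
    (fun t ht => (hasDerivAt_add_rpow _ _ κ τ (hrpos.trans_le ht.1)).hasDerivWithinAt) ?_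
    (right_mem_Icc.2 hs)
  · have e1 : r ^ κ * r ^ (-κ) = 1 := by rw [← Real.rpow_add hrpos]; simp
    have e2 : r ^ τ * r ^ (-τ) = 1 := by rw [← Real.rpow_add hrpos]; simp
    have : 0 < ε * A := by positivity
    simp only [mul_assoc, e1, e2]
    linarith
  · intro t ht heq
    have htr : r ≤ t := ht.1
    have ht0 : 0 < t := hrpos.trans_le htr
    rw [div_lt_div_iff_of_pos_right ht0]
    set β := t ^ (α - 1) * phiP p (v t) with hβ
    set b₁ := A / 2 * r ^ κ * t ^ (-κ) with hb₁
    set b₂ := ε * A * r ^ τ * t ^ (-τ) with hb₂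
    have hb₁0 : 0 < b₁ := by positivity
    have hb₂0 : 0 < b₂ := by positivity
    have hβ0 : 0 < β := by linarith
    have hv : 0 < v t := phiP_pos_iff.1 (pos_of_mul_pos_right hβ0 (by positivity))
    have hle (γ : ℝ) (hγ : 0 < γ) : r ^ γ * t ^ (-γ) ≤ 1 := by
      rw [Real.rpow_neg ht0.le, ← div_eq_mul_inv, div_le_one (by positivity)]
      gcongr
    have hβA : β ≤ A := by
      have h1 : b₁ ≤ A / 2 := by
        rw [hb₁, mul_assoc]
        exact mul_le_of_le_one_right (by positivity) (hle κ hκ0)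
      have h2 : b₂ ≤ ε * A := by
        rw [hb₂, mul_assoc]
        exact mul_le_of_le_one_right (by positivity) (hle τ hτ)
      nlinarith
    have hlarge : (κ + |α - n| + α + 1) * A < t ^ (α + 1) * v t := by
      by_contra! hcon
      have h1 := rpow_mul_abs_phiP_le hp hA.le (D := κ + |α - n| + α + 1) (by positivity) ht0
        (by rwa [abs_of_pos hv])
      rw [abs_of_pos (phiP_pos_iff.2 hv), ← hβ, ← hτdef] at h1
      have h2 := mul_le_mul_of_nonneg_right hbig (by positivity : 0 ≤ t ^ (-τ))
      have h3 : ε * (r ^ τ * A) * t ^ (-τ) = b₂ := by rw [hb₂]; ring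
      linarith
    have hwq : |w t| ^ (q - 1) ≤ 1 := Real.rpow_le_one (abs_nonneg _) (hw1 t htr) (by linarith)
    have hYt : |t ^ α * w t| ≤ A := by
      rw [abs_mul, abs_of_pos (by positivity)]; exact hY t htr
    have hlow : -((α + 1) * A) ≤ (α + |w t| ^ (q - 1)) * (t ^ α * w t) := by
      refine neg_le_of_abs_le ?_
      rw [abs_mul, abs_of_nonneg (by positivity)]
      gcongr
    have hmid : (α - n) * β ≤ |α - n| * A :=
      (mul_le_mul_of_nonneg_right (le_abs_self _) hβ0.le).trans (by gcongr)
    have hκβ : κ * b₁ + τ * b₂ ≤ κ * A := by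
      have : τ * b₂ ≤ κ * b₂ := by gcongr
      nlinarith
    linarith

/-- Upper bound for `r ^ α * (w r + phiP p (v r) / r)` obtained by integrating its
derivative from `r` to infinity. -/
theorem rpow_mul_add_flux_le (h : SolvesAfter n p q α r₀ w v) (hr₀ : 0 < r₀)
    {κ τ μ a b A r : ℝ} (hκ : 0 < κ) (hτ : 0 < τ) (hμ : 0 < μ) (hr : r₀ < r)
    (hw : ∀ s, r ≤ s → |w s| ^ (q - 1) ≤ s ^ (-μ)) (hY : ∀ s, r ≤ s → s ^ α * |w s| ≤ A)
    (hX : ∀ s, r ≤ s → s ^ (α - 1) * |phiP p (v s)| ≤ a * s ^ (-κ) + b * s ^ (-τ))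
    (h0 : Tendsto (fun s => s ^ α * w s) atTop (𝓝 0)) :
    r ^ α * w r + r ^ (α - 1) * phiP p (v r) ≤
      |α - n| * a / κ * r ^ (-κ) + |α - n| * b / τ * r ^ (-τ) + A / μ * r ^ (-μ) := by
  have hrpos : 0 < r := hr₀.trans hr
  set F : ℝ → ℝ := fun s => s ^ α * w s + s ^ (α - 1) * phiP p (v s)
    - ((|α - n| * a / κ * s ^ (-κ) + |α - n| * b / τ * s ^ (-τ))
      + (A / μ * s ^ (-μ) + 0 * s ^ (-μ))) with hF
  have hlim (γ : ℝ) (hγ : 0 < γ) (c : ℝ) : Tendsto (fun s : ℝ => c * s ^ (-γ)) atTop (𝓝 0) := by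
    simpa using (tendsto_rpow_neg_atTop hγ).const_mul c
  have hXlim : Tendsto (fun s => s ^ (α - 1) * phiP p (v s)) atTop (𝓝 0) := by
    refine squeeze_zero_norm' (a := fun s => a * s ^ (-κ) + b * s ^ (-τ)) ?_
      (by simpa using (hlim κ hκ a).add (hlim τ hτ b))
    filter_upwards [eventually_ge_atTop r] with s hs
    rw [Real.norm_eq_abs, abs_mul, abs_of_pos (Real.rpow_pos_of_pos (hrpos.trans_le hs) _)]
    exact hX s hs
  have hFlim : Tendsto F atTop (𝓝 0) := by
    simpa [hF] using (h0.add hXlim).sub (((hlim κ hκ (|α - n| * a / κ)).add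
      (hlim τ hτ (|α - n| * b / τ))).add ((hlim μ hμ (A / μ)).add (hlim μ hμ 0)))
  have hderiv : ∀ s, r ≤ s → ∃ F' : ℝ, HasDerivAt F F' s ∧ 0 ≤ F' := by
    intro s hs
    have hs0 : 0 < s := hrpos.trans_le hs
    have hs1 := hr.trans_le hs
    refine ⟨_, ((h.hasDerivAt_rpow_mul hr₀ α hs1).add (h.hasDerivAt_rpow_mul_flux hr₀ hs1)).sub
      ((hasDerivAt_add_rpow _ _ κ τ hs0).add (hasDerivAt_add_rpow _ _ μ μ hs0)), ?_⟩
    rw [← add_div, ← add_div, ← sub_div]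
    refine div_nonneg ?_ hs0.le
    have e1 : κ * (|α - n| * a / κ * s ^ (-κ)) + τ * (|α - n| * b / τ * s ^ (-τ))
        = |α - n| * (a * s ^ (-κ) + b * s ^ (-τ)) := by field_simp
    have e2 : μ * (A / μ * s ^ (-μ)) = A * s ^ (-μ) := by field_simp
    have hA : 0 ≤ A := le_trans (by positivity) (hY s hs)
    have e3 : |(α - n) * (s ^ (α - 1) * phiP p (v s))|
        ≤ |α - n| * (a * s ^ (-κ) + b * s ^ (-τ)) := by
      rw [abs_mul, abs_mul (s ^ (α - 1)), abs_of_pos (Real.rpow_pos_of_pos hs0 _)]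
      exact mul_le_mul_of_nonneg_left (hX s hs) (abs_nonneg _)
    have e4 : |(|w s| ^ (q - 1)) * (s ^ α * w s)| ≤ A * s ^ (-μ) := by
      rw [abs_mul, abs_mul (s ^ α), abs_of_pos (Real.rpow_pos_of_pos hs0 _),
        abs_of_nonneg (by positivity), mul_comm A]
      exact mul_le_mul (hw s hs) (hY s hs) (by positivity) (by positivity)
    have e5 : s ^ (α + 1) = s ^ α * s := Real.rpow_add_one hs0.ne' α
    rw [e1, e2, e5]
    have := neg_le_of_abs_le e3
    have := le_of_abs_le e4
    nlinarith
  have hmono : MonotoneOn F (Ici r) := by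
    refine monotoneOn_of_deriv_nonneg (convex_Ici r) ?_ ?_ ?_
    · intro s hs
      obtain ⟨F', h1, -⟩ := hderiv s hs
      exact h1.continuousAt.continuousWithinAt
    · intro s hs
      rw [interior_Ici] at hs
      obtain ⟨F', h1, -⟩ := hderiv s (le_of_lt hs)
      exact h1.differentiableAt.differentiableWithinAt
    · intro s hs
      rw [interior_Ici] at hs
      obtain ⟨F', h1, h2⟩ := hderiv s (le_of_lt hs)
      rwa [h1.deriv]
  have : F r ≤ 0 := ge_of_tendsto hFlim
    ((eventually_ge_atTop r).mono fun s hs => hmono self_mem_Ici hs hs)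
  simp only [hF] at this
  linarith

/-- Far out, a maximum of `s ^ α * |w s|` over `[r,∞)` that is large compared with the natural
scale cannot be attained at `r` unless the flux dominates there. -/
theorem exists_flux_large_of_max (h : SolvesAfter n p q α r₀ w v) (hr₀ : 0 < r₀) (hp : 1 < p)
    (hq : 1 < q) (hα : 0 < α) (hτ : 0 < p - α * (2 - p))
    (h0 : Tendsto (fun s => s ^ α * w s) atTop (𝓝 0)) :
    ∃ Λ R : ℝ, 0 < Λ ∧ r₀ < R ∧ ∀ r, R ≤ r → ∀ A, 0 < A → A = r ^ α * |w r| →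
      (∀ s, r ≤ s → s ^ α * |w s| ≤ A) →
      Λ * A ^ (p - 1) ≤ r ^ (p - α * (2 - p)) * A →
      A / 2 < r ^ (α - 1) * |phiP p (v r)| := by
  set τ := p - α * (2 - p) with hτdef
  set κ := max τ (4 * |α - n| + 1) with hκ
  set ε := min (1 / 2) (τ / (8 * (|α - n| + 1))) with hε
  set μ := α * (q - 1) with hμdef
  have hμ : 0 < μ := mul_pos hα (by linarith)
  have hκτ : τ ≤ κ := le_max_left _ _
  have hκ0 : 0 < κ := hτ.trans_le hκτ
  have hκ4 : 4 * |α - n| + 1 ≤ κ := le_max_right _ _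
  have hε0 : 0 < ε := by positivity
  have hε2 : ε ≤ 1 / 2 := min_le_left _ _
  have hετ : ε ≤ τ / (8 * (|α - n| + 1)) := min_le_right _ _
  set C := κ + |α - n| + α + 1 with hC
  have hC0 : 0 < C := by positivity
  obtain ⟨R₁, hR₁⟩ : ∃ R₁ : ℝ, ∀ s, R₁ ≤ s → |s ^ α * w s| < 1 ∧ s ^ (-μ) < μ / 8 := by
    refine eventually_atTop.1 (Filter.Eventually.and ?_ ?_)
    · exact h0.abs.eventually_lt_const (show |(0 : ℝ)| < 1 by simp)
    · exact (tendsto_rpow_neg_atTop hμ).eventually_lt_const (by positivity)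
  refine ⟨C ^ (p - 1) / ε, max (r₀ + 1) (max 1 R₁), by positivity,
    lt_of_lt_of_le (by linarith) (le_max_left _ _), ?_⟩
  intro r hr A hA hAr hY hΛ
  by_contra! hX
  have hrr₀ : r₀ < r := lt_of_lt_of_le (by linarith) ((le_max_left _ _).trans hr)
  have hr1 : 1 ≤ r := (le_max_left _ _).trans ((le_max_right _ _).trans hr)
  have hrR : R₁ ≤ r := (le_max_right _ _).trans ((le_max_right _ _).trans hr)
  have hrpos : 0 < r := hr₀.trans hrr₀
  have hwle : ∀ s, r ≤ s → |w s| ≤ s ^ (-α) := by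
    intro s hs
    have hs0 : 0 < s := hrpos.trans_le hs
    have := (hR₁ s (hrR.trans hs)).1
    rw [abs_mul, abs_of_pos (Real.rpow_pos_of_pos hs0 _)] at this
    rw [Real.rpow_neg hs0.le, ← one_div, le_div_iff₀ (Real.rpow_pos_of_pos hs0 _)]
    linarith
  have hw1 : ∀ s, r ≤ s → |w s| ≤ 1 := fun s hs =>
    (hwle s hs).trans (Real.rpow_le_one_of_one_le_of_nonpos (hr1.trans hs) (by linarith))
  have hwq : ∀ s, r ≤ s → |w s| ^ (q - 1) ≤ s ^ (-μ) := by
    intro s hs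
    have hs0 : 0 < s := hrpos.trans_le hs
    calc |w s| ^ (q - 1) ≤ (s ^ (-α)) ^ (q - 1) :=
          Real.rpow_le_rpow (abs_nonneg _) (hwle s hs) (by linarith)
      _ = s ^ (-μ) := by rw [← Real.rpow_mul hs0.le, hμdef]; ring_nf
  have hbig : C ^ (p - 1) * A ^ (p - 1) ≤ ε * (r ^ τ * A) := by
    have := mul_le_mul_of_nonneg_left hΛ hε0.le
    calc C ^ (p - 1) * A ^ (p - 1) = ε * (C ^ (p - 1) / ε * A ^ (p - 1)) := by field_simp
      _ ≤ _ := this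
  have hrα : 0 < r ^ (α - 1) := Real.rpow_pos_of_pos hrpos _
  have hXabs : |r ^ (α - 1) * phiP p (v r)| ≤ A / 2 := by
    rwa [abs_mul, abs_of_pos hrα]
  have hbar : ∀ s, r ≤ s → s ^ (α - 1) * |phiP p (v s)| ≤
      A / 2 * r ^ κ * s ^ (-κ) + ε * A * r ^ τ * s ^ (-τ) := by
    intro s hs
    have h1 := h.flux_le_barrier hr₀ hp hq hα hτ hκτ hε0 hε2 hA hrr₀ hw1 hY hbig
      (le_of_abs_le hXabs) hs
    have h2 := h.neg.flux_le_barrier hr₀ hp hq hα hτ hκτ hε0 hε2 hA hrr₀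
      (by simpa using hw1) (by simpa using hY) hbig
      (by rw [phiP_neg]; linarith [neg_le_of_abs_le hXabs]) hs
    rw [phiP_neg] at h2
    rcases abs_cases (phiP p (v s)) with ⟨e, -⟩ | ⟨e, -⟩ <;> rw [e]
    · exact h1
    · exact h2
  have h1 := h.rpow_mul_add_flux_le hr₀ hκ0 hτ hμ hrr₀ hwq hY hbar h0
  have h2 := h.neg.rpow_mul_add_flux_le hr₀ hκ0 hτ hμ hrr₀
    (by simpa using hwq) (by simpa using hY) (by simpa [phiP_neg] using hbar)
    (by simpa using h0.neg)
  rw [phiP_neg] at h2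
  have e1 : r ^ κ * r ^ (-κ) = 1 := by rw [← Real.rpow_add hrpos]; simp
  have e2 : r ^ τ * r ^ (-τ) = 1 := by rw [← Real.rpow_add hrpos]; simp
  have b1 : |α - n| * (A / 2 * r ^ κ) / κ * r ^ (-κ) ≤ A / 8 := by
    have : |α - n| * (A / 2 * r ^ κ) / κ * r ^ (-κ) = |α - n| * (A / 2) / κ := by
      linear_combination |α - n| * (A / 2) / κ * e1
    rw [this, div_le_iff₀ hκ0]
    nlinarith
  have b2 : |α - n| * (ε * A * r ^ τ) / τ * r ^ (-τ) ≤ A / 8 := by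
    have : |α - n| * (ε * A * r ^ τ) / τ * r ^ (-τ) = |α - n| * ε * A / τ := by
      linear_combination |α - n| * (ε * A) / τ * e2
    rw [this, div_le_iff₀ hτ]
    rw [le_div_iff₀ (by positivity)] at hετ
    nlinarith
  have b3 : A / μ * r ^ (-μ) ≤ A / 8 := by
    have := (hR₁ r hrR).2
    rw [div_mul_eq_mul_div, div_le_iff₀ hμ]
    nlinarith
  have hYabs : |r ^ α * w r| = A := by
    rw [abs_mul, abs_of_pos (Real.rpow_pos_of_pos hrpos _), hAr]
  have hX1 := le_of_abs_le hXabs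
  have hX2 := neg_le_of_abs_le hXabs
  rcases abs_cases (r ^ α * w r) with ⟨e, -⟩ | ⟨e, -⟩ <;> linarith

/-- As `exists_flux_large_of_max`, at points where the logarithmic derivative of `w` is
controlled. -/
theorem exists_lt_abs_deriv_of_max (h : SolvesAfter n p q α r₀ w v) (hr₀ : 0 < r₀) (hp : 1 < p)
    (hq : 1 < q) (hα : 0 < α) (hτ : 0 < p - α * (2 - p))
    (h0 : Tendsto (fun s => s ^ α * w s) atTop (𝓝 0)) {D : ℝ} (hD : 0 < D) :
    ∃ Λ R : ℝ, 0 < Λ ∧ r₀ < R ∧ ∀ r, R ≤ r → ∀ A, 0 < A → A = r ^ α * |w r| →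
      (∀ s, r ≤ s → s ^ α * |w s| ≤ A) →
      Λ * A ^ (p - 1) ≤ r ^ (p - α * (2 - p)) * A →
      D * |w r| < r * |v r| := by
  obtain ⟨Λ, R, hΛ, hR, H⟩ := h.exists_flux_large_of_max hr₀ hp hq hα hτ h0
  refine ⟨max Λ (2 * D ^ (p - 1)), R, lt_max_of_lt_left hΛ, hR, ?_⟩
  intro r hr A hA hAr hY hbig
  by_contra! hcon
  have hrpos : 0 < r := hr₀.trans (hR.trans_le hr)
  have hA' : 0 < A ^ (p - 1) := Real.rpow_pos_of_pos hA _
  have h1 := H r hr A hA hAr hY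
    ((mul_le_mul_of_nonneg_right (le_max_left _ _) hA'.le).trans hbig)
  have h2 := (mul_le_mul_of_nonneg_right (le_max_right Λ _) hA'.le).trans hbig
  have h3 := rpow_mul_abs_phiP_le (α := α) (x := v r) hp hA.le hD.le hrpos (by
    rw [Real.rpow_add_one hrpos.ne', hAr]
    have : 0 < r ^ α := Real.rpow_pos_of_pos hrpos _
    nlinarith)
  set τ := p - α * (2 - p)
  have e2 : r ^ τ * r ^ (-τ) = 1 := by rw [← Real.rpow_add hrpos]; simp
  have h4 := mul_le_mul_of_nonneg_right h2 (Real.rpow_pos_of_pos hrpos (-τ)).le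
  have h5 : r ^ τ * A * r ^ (-τ) = A := by linear_combination A * e2
  linarith

theorem continuousOn_rpow_mul_abs (h : SolvesAfter n p q α r₀ w v) (hr₀ : 0 < r₀) (γ : ℝ) :
    ContinuousOn (fun s => s ^ γ * |w s|) (Ioi r₀) := fun s hs =>
  ((Real.continuousAt_rpow_const s γ (Or.inl (hr₀.trans hs).ne')).mul
    (h.hasDerivAt s hs).continuousAt.abs).continuousWithinAt

theorem exists_max_rpow_mul_abs (h : SolvesAfter n p q α r₀ w v) (hr₀ : 0 < r₀)
    (h0 : Tendsto (fun s => s ^ α * w s) atTop (𝓝 0)) {r s₀ : ℝ} (hr : r₀ < r) (hs : r ≤ s₀)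
    (hw : w s₀ ≠ 0) : ∃ c, r ≤ c ∧ ∀ s, r ≤ s → s ^ α * |w s| ≤ c ^ α * |w c| := by
  refine exists_max_of_tendsto_zero
    ((h.continuousOn_rpow_mul_abs hr₀ α).mono (Ici_subset_Ioi.2 hr)) ?_ hs
    (mul_pos (Real.rpow_pos_of_pos (hr₀.trans (hr.trans_le hs)) _) (abs_pos.2 hw))
  have h1 : Tendsto (fun s => |s ^ α * w s|) atTop (𝓝 0) := by simpa using h0.abs
  refine h1.congr' ?_
  filter_upwards [eventually_gt_atTop 0] with s hs
  rw [abs_mul, abs_of_pos (Real.rpow_pos_of_pos hs _)]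

theorem hasDerivAt_sq_rpow_mul (h : SolvesAfter n p q α r₀ w v) (hr₀ : 0 < r₀) (γ : ℝ) {r : ℝ}
    (hr : r₀ < r) :
    HasDerivAt (fun s => (s ^ γ * w s) ^ 2)
      (2 * (r ^ γ) ^ 2 / r * (γ * w r ^ 2 + r * v r * w r)) r := by
  refine ((h.hasDerivAt_rpow_mul hr₀ γ hr).pow 2).congr_deriv ?_
  simp only [Nat.cast_ofNat]
  ring

theorem sq_rpow_mul_le {γ r s : ℝ} (hr : 0 < r) (hs : 0 < s)
    (hle : s ^ γ * |w s| ≤ r ^ γ * |w r|) : (s ^ γ * w s) ^ 2 ≤ (r ^ γ * w r) ^ 2 := by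
  rw [sq_le_sq, abs_mul, abs_mul, abs_of_pos (Real.rpow_pos_of_pos hr _),
    abs_of_pos (Real.rpow_pos_of_pos hs _)]
  exact hle

theorem mul_deriv_le_of_max_right (h : SolvesAfter n p q α r₀ w v) (hr₀ : 0 < r₀) {γ r : ℝ}
    (hr : r₀ < r) (hmax : ∀ s, r ≤ s → s ^ γ * |w s| ≤ r ^ γ * |w r|) :
    r * v r * w r ≤ -(γ * w r ^ 2) := by
  have hrpos : 0 < r := hr₀.trans hr
  have h1 := (h.hasDerivAt_sq_rpow_mul hr₀ γ hr).nonpos_of_max_right fun s hs =>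
    sq_rpow_mul_le hrpos (hrpos.trans_le hs) (hmax s hs)
  have h2 : 0 < 2 * (r ^ γ) ^ 2 / r := by positivity
  linarith [nonpos_of_mul_nonpos_right h1 h2]

theorem le_mul_deriv_of_max_left (h : SolvesAfter n p q α r₀ w v) (hr₀ : 0 < r₀) {γ a r : ℝ}
    (ha : r₀ < a) (har : a < r)
    (hmax : ∀ s, a ≤ s → s ≤ r → s ^ γ * |w s| ≤ r ^ γ * |w r|) :
    -(γ * w r ^ 2) ≤ r * v r * w r := by
  have hapos : 0 < a := hr₀.trans ha
  have hrpos : 0 < r := hapos.trans har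
  have h1 := (h.hasDerivAt_sq_rpow_mul hr₀ γ (ha.trans har)).nonneg_of_max_left har
    fun s hs hs' => sq_rpow_mul_le hrpos (hapos.trans_le hs) (hmax s hs hs')
  have h2 : 0 < 2 * (r ^ γ) ^ 2 / r := by positivity
  linarith [nonneg_of_mul_nonneg_right h1 h2]

theorem abs_deriv_le_of_mul_deriv_bounds {γ D r x y : ℝ} (hr : 0 < r) (hα : 0 < α) (hγ : γ ≤ D)
    (hy : y ≠ 0) (h1 : r * x * y ≤ -(α * y ^ 2)) (h2 : -(γ * y ^ 2) ≤ r * x * y) :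
    r * |x| ≤ D * |y| := by
  have hy2 : 0 < y ^ 2 := by positivity
  have h3 : |r * x * y| ≤ D * y ^ 2 := by
    rw [abs_le]
    constructor <;> nlinarith
  rw [abs_mul, abs_mul, abs_of_pos hr, ← sq_abs] at h3
  have hy' : 0 < |y| := abs_pos.2 hy
  nlinarith

theorem exists_forall_ge_eq_zero (h : SolvesAfter n p q α r₀ w v) (hr₀ : 0 < r₀) (hp : 2 < p)
    (hq : 1 < q) (hα : 0 < α) (h0 : Tendsto (fun s => s ^ α * w s) atTop (𝓝 0)) :
    ∃ R : ℝ, 0 < R ∧ ∀ r ∈ Ici R, w r = 0 := by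
  have hp1 : 1 < p := by linarith
  have hτ : 0 < p - α * (2 - p) := by nlinarith
  obtain ⟨Λ₁, R₁, hΛ₁, hR₁, H₁⟩ := h.exists_flux_large_of_max hr₀ hp1 hq hα hτ h0
  obtain ⟨Λ₂, R₂, hΛ₂, hR₂, H₂⟩ := h.exists_lt_abs_deriv_of_max hr₀ hp1 hq hα hτ h0 hα
  set τ := p - α * (2 - p)
  obtain ⟨R₃, hR₃⟩ : ∃ R₃ : ℝ, ∀ s, R₃ ≤ s →
      |s ^ α * w s| < 1 ∧ Λ₁ ≤ s ^ τ ∧ Λ₂ ≤ s ^ τ ∧ 2 ≤ s := by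
    refine eventually_atTop.1 (.and ?_ (.and ?_ (.and ?_ (eventually_ge_atTop 2))))
    · exact h0.abs.eventually_lt_const (show |(0 : ℝ)| < 1 by simp)
    · exact (tendsto_rpow_atTop hτ).eventually_ge_atTop Λ₁
    · exact (tendsto_rpow_atTop hτ).eventually_ge_atTop Λ₂
  set R := max R₁ (max R₂ R₃)
  have hRR₁ : R₁ ≤ R := le_max_left _ _
  have hRR₂ : R₂ ≤ R := (le_max_left _ _).trans (le_max_right _ _)
  have hRR₃ : R₃ ≤ R := (le_max_right _ _).trans (le_max_right _ _)
  have hR₀ : r₀ < R := hR₁.trans_le hRR₁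
  have hRpos : 0 < R := hr₀.trans hR₀
  by_contra! hcon
  have hbig : ∀ r, R ≤ r → ∀ Λ, Λ ≤ r ^ τ →
      Λ * (r ^ α * |w r|) ^ (p - 1) ≤ r ^ τ * (r ^ α * |w r|) := by
    intro r hr Λ hΛ
    have hrpos : 0 < r := hRpos.trans_le hr
    have h1 := (hR₃ r (hRR₃.trans hr)).1.le
    rw [abs_mul, abs_of_pos (Real.rpow_pos_of_pos hrpos _)] at h1
    have h2 : (r ^ α * |w r|) ^ (p - 1) ≤ r ^ α * |w r| := by
      simpa using Real.rpow_le_rpow_of_exponent_ge' (by positivity) h1 zero_le_one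
        (by linarith : 1 ≤ p - 1)
    exact mul_le_mul hΛ h2 (by positivity) (by positivity)
  have hmax : ∀ r, R ≤ r → w r ≠ 0 ∧ ∀ s, r ≤ s → s ^ α * |w s| ≤ r ^ α * |w r| := by
    intro r hr
    obtain ⟨s₀, hs₀, hws₀⟩ := hcon r (hRpos.trans_le hr)
    obtain ⟨c, hrc, hc⟩ := h.exists_max_rpow_mul_abs hr₀ h0 (hR₀.trans_le hr) hs₀ hws₀
    have hcpos : 0 < c := hRpos.trans_le (hr.trans hrc)
    have hAc : 0 < c ^ α * |w c| := lt_of_lt_of_le (mul_pos (Real.rpow_pos_of_pos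
      (hRpos.trans_le (hr.trans hs₀)) _) (abs_pos.2 hws₀)) (hc s₀ hs₀)
    have hwc : w c ≠ 0 := by
      intro h
      simp [h] at hAc
    rcases hrc.eq_or_lt with rfl | hlt
    · exact ⟨hwc, hc⟩
    · exfalso
      have hcR := hr.trans hrc
      have hc' : ∀ s, c ≤ s → s ^ α * |w s| ≤ c ^ α * |w c| := fun s hs => hc s (hrc.trans hs)
      have h1 := h.mul_deriv_le_of_max_right hr₀ (hR₀.trans_le hcR) hc'
      have h2 := h.le_mul_deriv_of_max_left hr₀ (hR₀.trans_le hr) hlt fun s hs _ => hc s hs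
      have h3 := abs_deriv_le_of_mul_deriv_bounds hcpos hα le_rfl hwc h1 h2
      exact h3.not_gt (H₂ c (hRR₂.trans hcR) _ hAc rfl hc'
        (hbig c hcR Λ₂ (hR₃ c (hRR₃.trans hcR)).2.2.1))
  have hslope : ∀ r, R ≤ r → |w r| ^ (1 / (p - 1)) ≤ |v r| ∧ w r * v r = -(|w r| * |v r|) := by
    intro r hr
    obtain ⟨hwr, hm⟩ := hmax r hr
    have hrpos : 0 < r := hRpos.trans_le hr
    have hA : 0 < r ^ α * |w r| := mul_pos (Real.rpow_pos_of_pos hrpos _) (abs_pos.2 hwr)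
    have h1 := H₁ r (hRR₁.trans hr) _ hA rfl hm (hbig r hr Λ₁ (hR₃ r (hRR₃.trans hr)).2.1)
    have hr2 : 2 ≤ r := (hR₃ r (hRR₃.trans hr)).2.2.2
    constructor
    · rw [abs_phiP hp1, Real.rpow_sub_one hrpos.ne'] at h1
      have hrα : 0 < r ^ α := Real.rpow_pos_of_pos hrpos _
      have h2 : |w r| ≤ |v r| ^ (p - 1) := by
        have h3 : r ^ α * |w r| / 2 * r < r ^ α * |v r| ^ (p - 1) := by
          have := mul_lt_mul_of_pos_right h1 hrpos
          have e : r ^ α / r * |v r| ^ (p - 1) * r = r ^ α * |v r| ^ (p - 1) := by field_simp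
          rwa [e] at this
        have h4 : r ^ α * (|w r| * (r / 2)) < r ^ α * |v r| ^ (p - 1) := by linarith
        have h5 := lt_of_mul_lt_mul_left h4 hrα.le
        nlinarith [abs_nonneg (w r)]
      calc |w r| ^ (1 / (p - 1)) ≤ (|v r| ^ (p - 1)) ^ (1 / (p - 1)) := by
            have : 0 ≤ 1 / (p - 1) := by
              have : 0 < p - 1 := by linarith
              positivity
            gcongr
        _ = |v r| := by
            rw [← Real.rpow_mul (abs_nonneg _), mul_one_div_cancel (by linarith), Real.rpow_one]
    · have h2 := h.mul_deriv_le_of_max_right hr₀ (hR₀.trans_le hr) hm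
      have h3 : w r * v r ≤ 0 := by
        have : 0 < α * w r ^ 2 := by positivity
        have : r * (w r * v r) ≤ 0 := by linarith
        exact nonpos_of_mul_nonpos_right this hrpos
      rw [← abs_mul, abs_of_nonpos h3, neg_neg]
  set k := (p - 2) / (p - 1) with hk
  have hk0 : 0 < k := div_pos (by linarith) (by linarith)
  set f : ℝ → ℝ := fun s => (w s ^ 2) ^ (k / 2) + k * s with hf
  have hderiv : ∀ s, R ≤ s → ∃ f' : ℝ, HasDerivAt f f' s ∧ f' ≤ 0 := by
    intro s hs
    obtain ⟨hws, -⟩ := hmax s hs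
    obtain ⟨h1, h2⟩ := hslope s hs
    have hws' : 0 < |w s| := abs_pos.2 hws
    refine ⟨_, ((((h.hasDerivAt s (hR₀.trans_le hs)).pow 2).rpow_const (p := k / 2)
      (Or.inl (pow_ne_zero 2 hws))).add ((hasDerivAt_id s).const_mul k)), ?_⟩
    have e1 : (w s ^ 2) ^ (k / 2 - 1) = |w s| ^ (k - 2) := by
      rw [← sq_abs, ← Real.rpow_natCast, ← Real.rpow_mul hws'.le]
      congr 1
      push_cast
      ring
    have e2 : |w s| ^ (k - 2) * (|w s| * |w s| ^ (1 / (p - 1))) = 1 := by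
      nth_rewrite 2 [← Real.rpow_one |w s|]
      rw [← Real.rpow_add hws', ← Real.rpow_add hws']
      have : k - 2 + (1 + 1 / (p - 1)) = 0 := by
        have : p - 1 ≠ 0 := by linarith
        rw [hk]
        field_simp
        ring
      rw [this, Real.rpow_zero]
    have h3 : |w s| ^ (k - 2) * (|w s| * |w s| ^ (1 / (p - 1)))
        ≤ |w s| ^ (k - 2) * (|w s| * |v s|) := by gcongr
    rw [e2] at h3
    simp only [Nat.cast_ofNat, Pi.pow_apply, e1, Nat.add_one_sub_one, pow_one, mul_one]
    linear_combination k * h3 + k * |w s| ^ (k - 2) * h2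
  have hanti : AntitoneOn f (Ici R) := by
    refine antitoneOn_of_deriv_nonpos (convex_Ici R) ?_ ?_ ?_
    · intro s hs
      obtain ⟨f', h1, -⟩ := hderiv s hs
      exact h1.continuousAt.continuousWithinAt
    · intro s hs
      rw [interior_Ici] at hs
      obtain ⟨f', h1, -⟩ := hderiv s (le_of_lt hs)
      exact h1.differentiableAt.differentiableWithinAt
    · intro s hs
      rw [interior_Ici] at hs
      obtain ⟨f', h1, h2⟩ := hderiv s (le_of_lt hs)
      rwa [h1.deriv]
  have hfR : 0 ≤ (w R ^ 2) ^ (k / 2) := by positivity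
  have hT : R ≤ (w R ^ 2) ^ (k / 2) / k + R + 1 := by
    have : 0 ≤ (w R ^ 2) ^ (k / 2) / k := by positivity
    linarith
  have h1 := hanti self_mem_Ici hT hT
  simp only [hf] at h1
  set T := (w R ^ 2) ^ (k / 2) / k + R + 1 with hTdef
  have h2 : k * T = (w R ^ 2) ^ (k / 2) + k * R + k := by
    rw [hTdef]
    field_simp
  have h3 : 0 ≤ (w T ^ 2) ^ (k / 2) := by positivity
  linarith

theorem isBigO_rpow (h : SolvesAfter n p q α r₀ w v) (hr₀ : 0 < r₀) (hp : 1 < p) (hp2 : p < 2)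
    (hq : 1 < q) (hα : 0 < α) (hαδ : α < p / (2 - p))
    (h0 : Tendsto (fun s => s ^ α * w s) atTop (𝓝 0)) :
    w =O[atTop] fun r : ℝ => r ^ (-(p / (2 - p))) := by
  have hp2' : 0 < 2 - p := by linarith
  have hτ : 0 < p - α * (2 - p) := by
    rw [lt_div_iff₀ hp2'] at hαδ
    linarith
  set δ := p / (2 - p) with hδ
  have hδ0 : 0 < δ := hα.trans hαδ
  have hδτ : (δ - α) * (2 - p) = p - α * (2 - p) := by
    rw [hδ]
    field_simp
  obtain ⟨Λ, R, hΛ, hR, H⟩ := h.exists_lt_abs_deriv_of_max hr₀ hp hq hα hτ h0 hδ0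
  have hRpos : 0 < R := hr₀.trans hR
  set K := Λ ^ (1 / (2 - p)) with hK
  have hK0 : 0 < K := Real.rpow_pos_of_pos hΛ _
  set M := max K (R ^ δ * |w R|) with hM
  have hscale : ∀ r, R ≤ r → r ^ δ * |w r| = r ^ (δ - α) * (r ^ α * |w r|) := by
    intro r hr
    rw [← mul_assoc, ← Real.rpow_add (hRpos.trans_le hr)]
    ring_nf
  have hbound : ∀ r, R ≤ r → r ^ δ * |w r| ≤ M := by
    intro r₁ hr₁
    by_contra! hcon
    obtain ⟨r₂, hr₂, hmax⟩ := isCompact_Icc.exists_isMaxOn ⟨r₁, right_mem_Icc.2 hr₁⟩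
      ((h.continuousOn_rpow_mul_abs hr₀ δ).mono fun s (hs : s ∈ Icc R r₁) => hR.trans_le hs.1)
    have hz₂ : M < r₂ ^ δ * |w r₂| := hcon.trans_le (hmax (right_mem_Icc.2 hr₁))
    have hRr₂ : R < r₂ := by
      refine lt_of_le_of_ne hr₂.1 fun heq => ?_
      rw [← heq] at hz₂
      exact (le_max_right _ _).not_gt hz₂
    have hr₂pos : 0 < r₂ := hRpos.trans hRr₂
    have hM0 : 0 < M := lt_max_of_lt_left hK0
    have hw₂ : w r₂ ≠ 0 := by
      intro h
      simp only [h, abs_zero, mul_zero] at hz₂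
      linarith
    obtain ⟨c, hrc, hc⟩ := h.exists_max_rpow_mul_abs hr₀ h0 (hR.trans hRr₂) le_rfl hw₂
    have hRc : R ≤ c := hRr₂.le.trans hrc
    have hcpos : 0 < c := hRpos.trans_le hRc
    have hzc : K < c ^ δ * |w c| := by
      refine (le_max_left K _).trans_lt (hz₂.trans_le ?_)
      rw [hscale r₂ hRr₂.le, hscale c hRc]
      have : r₂ ^ (δ - α) ≤ c ^ (δ - α) := Real.rpow_le_rpow hr₂pos.le hrc (by linarith)
      have := hc r₂ le_rfl
      gcongr
    have hwc : w c ≠ 0 := by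
      intro h
      simp only [h, abs_zero, mul_zero] at hzc
      linarith
    have hA : 0 < c ^ α * |w c| := mul_pos (Real.rpow_pos_of_pos hcpos _) (abs_pos.2 hwc)
    have hc' : ∀ s, c ≤ s → s ^ α * |w s| ≤ c ^ α * |w c| := fun s hs => hc s (hrc.trans hs)
    have hbig : Λ * (c ^ α * |w c|) ^ (p - 1) ≤ c ^ (p - α * (2 - p)) * (c ^ α * |w c|) := by
      have h1 : Λ ≤ c ^ (p - α * (2 - p)) * (c ^ α * |w c|) ^ (2 - p) := by
        have h2 := Real.rpow_le_rpow hK0.le hzc.le hp2'.le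
        rwa [hK, ← Real.rpow_mul hΛ.le, one_div_mul_cancel hp2'.ne', Real.rpow_one,
          hscale c hRc, Real.mul_rpow (by positivity) hA.le, ← Real.rpow_mul hcpos.le,
          hδτ] at h2
      have h3 := mul_le_mul_of_nonneg_right h1 (Real.rpow_pos_of_pos hA (p - 1)).le
      rwa [mul_assoc, ← Real.rpow_add hA, show 2 - p + (p - 1) = 1 by ring, Real.rpow_one] at h3
    have h1 := h.mul_deriv_le_of_max_right hr₀ (hR.trans_le hRc) hc'
    have h2 : c * |v c| ≤ δ * |w c| := by
      rcases hrc.eq_or_lt with rfl | hlt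
      · exact abs_deriv_le_of_mul_deriv_bounds hcpos hα le_rfl hwc h1
          (h.le_mul_deriv_of_max_left hr₀ hR hRr₂ fun s hs hs' => hmax ⟨hs, hs'.trans hr₂.2⟩)
      · exact abs_deriv_le_of_mul_deriv_bounds hcpos hα hαδ.le hwc h1
          (h.le_mul_deriv_of_max_left hr₀ (hR.trans hRr₂) hlt fun s hs _ => hc s hs)
    exact h2.not_gt (H c hRc _ hA rfl hc' hbig)
  refine IsBigO.of_bound M ?_
  filter_upwards [eventually_ge_atTop R] with r hr
  have hrpos : 0 < r := hRpos.trans_le hr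
  rw [Real.norm_eq_abs, Real.norm_of_nonneg (by positivity), Real.rpow_neg hrpos.le,
    ← div_eq_mul_inv, le_div_iff₀ (by positivity), mul_comm]
  exact hbound r hr

end SolvesAfter

/-- Assume (L). Let `w` solve (E) on `[r₀,∞)` with `lim_{r→∞} r^α w(r) = 0`.
(i) If `p > 2`, `w` has compact support. (ii) If `p < 2`, `w(r) = O(r^{-δ})`. -/
theorem stmt9 (N : ℕ) (hN : 1 ≤ N) (p q α : ℝ) (hp : 1 < p) (hq : 1 < q) (hα : 0 < α)
    (hL : 2 < p ∨ (p < 2 ∧ α < p / (2 - p)))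
    (r₀ : ℝ) (hr₀ : 0 < r₀) (w : ℝ → ℝ) (hw : IsSolutionOn N p q α w (Ici r₀))
    (h0 : Tendsto (fun r => r ^ α * w r) atTop (𝓝 0)) :
    (2 < p → ∃ R : ℝ, 0 < R ∧ ∀ r ∈ Ici R, w r = 0) ∧
    (p < 2 → w =O[atTop] fun r : ℝ => r ^ (-(p / (2 - p)))) := by
  have h := hw.solvesAfter
  refine ⟨fun hp2 => h.exists_forall_ge_eq_zero hr₀ hp2 hq hα h0, fun hp2 => ?_⟩
  have hαδ := (hL.resolve_left hp2.not_gt).2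
  exact h.isBigO_rpow hr₀ hp hp2 hq hα hαδ h0
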